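/- Let k, d ∈ ℕ with k, d ≥ 1, and let f : ℝ^d → ℝ be a two-hidden-layer tanh neural network on ℝ^d with hidden widths W ≥ d whose maximal weight is at most W_max, where W_max ≥ 1. Then ‖f‖_{W^{k,∞}([−1,1]^d)} ≤ 16²·(e²·k⁴·d²)^{2k}·(2k)^{2k(k+1)}·W_max^{2k+1}·W^{3k+1}·d^k. In particular, every mixed partial derivative of f of order at most k is bounded on [−1,1]^d by this quantity. -/

import Mathlib

/-- Mixed partial derivative of `f` taken successively in the coordinate directions
listed in `L` (using the Fréchet derivative in the direction of the standard basis vectors). -/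
noncomputable def mixedDeriv {d : ℕ} {E : Type*} [NormedAddCommGroup E] [NormedSpace ℝ E] :
    List (Fin d) → ((Fin d → ℝ) → E) → ((Fin d → ℝ) → E)
  | [] => fun f => f
  | i :: L => fun f x => fderiv ℝ (mixedDeriv L f) x (Pi.single i 1)

/-- A two-hidden-layer tanh neural network on `ℝ^d` with hidden widths `W₁` and `W₂`:
the data of the input layer weights/biases, hidden layer weights/biases, and
output layer weights/bias. -/
structure TanhNet (d W₁ W₂ : ℕ) where
  Win : Fin W₁ → Fin d → ℝ
  bin : Fin W₁ → ℝ
  Whid : Fin W₂ → Fin W₁ → ℝ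
  bhid : Fin W₂ → ℝ
  Wout : Fin W₂ → ℝ
  bout : ℝ

/-- Evaluation of a two-hidden-layer tanh neural network:
`f(x) = W_out · tanh(W_hidden · tanh(W_in · x + b_in) + b_hidden) + b_out`. -/
noncomputable def TanhNet.eval {d W₁ W₂ : ℕ} (net : TanhNet d W₁ W₂) (x : Fin d → ℝ) : ℝ :=
  (∑ i, net.Wout i *
      Real.tanh ((∑ j, net.Whid i j *
        Real.tanh ((∑ l, net.Win j l * x l) + net.bin j)) + net.bhid i)) + net.bout

/-- All weights and biases of the network are bounded in absolute value by `M`,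
i.e. the maximal weight of the network is at most `M`. -/
def TanhNet.WeightsLe {d W₁ W₂ : ℕ} (net : TanhNet d W₁ W₂) (M : ℝ) : Prop :=
  (∀ i j, |net.Win i j| ≤ M) ∧ (∀ i, |net.bin i| ≤ M) ∧
  (∀ i j, |net.Whid i j| ≤ M) ∧ (∀ i, |net.bhid i| ≤ M) ∧
  (∀ i, |net.Wout i| ≤ M) ∧ |net.bout| ≤ M

theorem Real.hasDerivAt_tanh_pow (m : ℕ) (x : ℝ) :
    HasDerivAt (fun y => Real.tanh y ^ m)
      (m * (Real.tanh x ^ (m - 1) - Real.tanh x ^ (m + 1))) x := by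
  have hc : Real.cosh x ≠ 0 := (Real.cosh_pos x).ne'
  have h : HasDerivAt Real.tanh (1 - Real.tanh x ^ 2) x := by
    have h0 := (Real.hasDerivAt_sinh x).div (Real.hasDerivAt_cosh x) hc
    have he : (Real.sinh / Real.cosh) = Real.tanh := by
      funext y; simp [Real.tanh_eq_sinh_div_cosh]
    rw [he] at h0
    refine h0.congr_deriv ?_
    rw [Real.tanh_eq_sinh_div_cosh]
    field_simp
  refine (h.fun_pow m).congr_deriv ?_
  rcases m with _ | m
  · simp
  · simp only [Nat.add_sub_cancel]
    ring

theorem Real.contDiff_tanh {n : WithTop ℕ∞} : ContDiff ℝ n Real.tanh := by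
  have he : Real.tanh = fun y => Real.sinh y / Real.cosh y := by
    funext y; exact Real.tanh_eq_sinh_div_cosh y
  rw [he]
  exact Real.contDiff_sinh.div Real.contDiff_cosh fun x => (Real.cosh_pos x).ne'

theorem Real.abs_tanh_le_one (x : ℝ) : |Real.tanh x| ≤ 1 :=
  abs_le.2 ⟨(Real.neg_one_lt_tanh x).le, (Real.tanh_lt_one x).le⟩

theorem Real.abs_iteratedDeriv_tanh_pow_le (n m : ℕ) (x : ℝ) :
    |iteratedDeriv n (fun y => Real.tanh y ^ m) x| ≤ 2 ^ n * ((m : ℝ) + n) ^ n := by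
  induction n generalizing m with
  | zero =>
    simpa [abs_pow] using pow_le_one₀ (abs_nonneg _) (Real.abs_tanh_le_one x)
  | succ n ih =>
    have hd : deriv (fun y => Real.tanh y ^ m) =
        fun y => (m : ℝ) * ((fun y => Real.tanh y ^ (m - 1)) - fun y => Real.tanh y ^ (m + 1)) y :=
      funext fun y => (Real.hasDerivAt_tanh_pow m y).deriv
    have hs (l : ℕ) : ContDiffAt ℝ n (fun y => Real.tanh y ^ l) x :=
      (Real.contDiff_tanh.pow l).contDiffAt
    rw [iteratedDeriv_succ', hd, iteratedDeriv_const_mul_field, iteratedDeriv_sub (hs _) (hs _),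
      abs_mul, Nat.abs_cast]
    have hm : ((m - 1 : ℕ) : ℝ) ≤ (m : ℝ) + 1 := by
      exact_mod_cast (Nat.sub_le m 1).trans (Nat.le_succ m)
    have h1 : |iteratedDeriv n (fun y => Real.tanh y ^ (m - 1)) x| ≤
        2 ^ n * ((m : ℝ) + 1 + n) ^ n := (ih (m - 1)).trans (by gcongr)
    have h2 : |iteratedDeriv n (fun y => Real.tanh y ^ (m + 1)) x| ≤
        2 ^ n * ((m : ℝ) + 1 + n) ^ n := by simpa using ih (m + 1)
    calc (m : ℝ) * |iteratedDeriv n (fun y => Real.tanh y ^ (m - 1)) x -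
            iteratedDeriv n (fun y => Real.tanh y ^ (m + 1)) x|
        ≤ ((m : ℝ) + 1 + n) * (2 ^ n * ((m : ℝ) + 1 + n) ^ n + 2 ^ n * ((m : ℝ) + 1 + n) ^ n) := by
          refine mul_le_mul ?_ ((abs_sub _ _).trans (add_le_add h1 h2)) (abs_nonneg _)
            (by positivity)
          linarith [(Nat.cast_nonneg n : (0 : ℝ) ≤ n)]
      _ = 2 ^ (n + 1) * ((m : ℝ) + (n + 1 : ℕ)) ^ (n + 1) := by
          push_cast
          ring

theorem Real.norm_iteratedFDeriv_tanh_le {n k : ℕ} (hk : 1 ≤ k) (hn : n ≤ k) (x : ℝ) :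
    ‖iteratedFDeriv ℝ n Real.tanh x‖ ≤ (2 * (k : ℝ)) ^ (2 * k) := by
  have hk' : (1 : ℝ) ≤ k := by exact_mod_cast hk
  have hn' : (n : ℝ) ≤ k := by exact_mod_cast hn
  rw [norm_iteratedFDeriv_eq_norm_iteratedDeriv, Real.norm_eq_abs]
  have h := Real.abs_iteratedDeriv_tanh_pow_le n 1 x
  simp only [pow_one, Nat.cast_one] at h
  calc _ ≤ 2 ^ n * ((1 : ℝ) + n) ^ n := h
    _ ≤ (2 * (k : ℝ)) ^ n * (2 * (k : ℝ)) ^ n := by gcongr <;> linarith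
    _ = (2 * (k : ℝ)) ^ (2 * n) := by ring
    _ ≤ (2 * (k : ℝ)) ^ (2 * k) := pow_le_pow_right₀ (by linarith) (by omega)

section

variable {E : Type*} [NormedAddCommGroup E] [NormedSpace ℝ E]

theorem norm_iteratedFDeriv_sum_const_mul_add_const_le {ι : Type*} [Fintype ι] {n : ℕ}
    {a : ι → ℝ} {b M B : ℝ} {h : ι → E → ℝ} {x : E} (hh : ∀ j, ContDiff ℝ n (h j))
    (ha : ∀ j, |a j| ≤ M) (hb : |b| ≤ M) (hB : ∀ j, ‖iteratedFDeriv ℝ n (h j) x‖ ≤ B) :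
    ‖iteratedFDeriv ℝ n (fun y => (∑ j, a j * h j y) + b) x‖ ≤ Fintype.card ι * (M * B) + M := by
  have hM : 0 ≤ M := (abs_nonneg b).trans hb
  have hs (j : ι) : ContDiff ℝ n (fun y => a j * h j y) := contDiff_const.mul (hh j)
  have hsum : ContDiff ℝ n (fun y => ∑ j, a j * h j y) := ContDiff.sum fun j _ => hs j
  rw [fun_iteratedFDeriv_add_apply hsum.contDiffAt contDiff_const.contDiffAt]
  refine (norm_add_le _ _).trans (add_le_add ?_ ?_)
  · rw [iteratedFDeriv_fun_sum_apply fun j _ => (hs j).contDiffAt]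
    refine (norm_sum_le_of_le _ (f := fun j => iteratedFDeriv ℝ n (fun y => a j * h j y) x)
      (n := fun _ => M * B) fun j _ => ?_).trans (by simp)
    have := iteratedFDeriv_const_smul_apply' (a := a j) (hh j).contDiffAt (x := x)
    simp only [smul_eq_mul] at this
    rw [this, norm_smul, Real.norm_eq_abs]
    exact mul_le_mul (ha j) (hB j) (norm_nonneg _) hM
  · rcases eq_or_ne n 0 with rfl | hn
    · simpa using hb
    · simpa [iteratedFDeriv_const_of_ne hn] using hM

theorem norm_iteratedFDeriv_comp_clm_add_const_le {F : Type*} [NormedAddCommGroup F]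
    [NormedSpace ℝ F] {n : ℕ} {g : F → ℝ} (hg : ContDiff ℝ n g) {B : ℝ}
    (hB : ∀ y, ‖iteratedFDeriv ℝ n g y‖ ≤ B) (A : E →L[ℝ] F) (b : F) (x : E) :
    ‖iteratedFDeriv ℝ n (fun y => g (A y + b)) x‖ ≤ B * ‖A‖ ^ n := by
  have h := A.iteratedFDeriv_comp_right (f := fun y => g (y + b))
    (hg.comp (contDiff_id.add contDiff_const)) x le_rfl
  change ‖iteratedFDeriv ℝ n ((fun y => g (y + b)) ∘ A) x‖ ≤ _
  rw [h, iteratedFDeriv_comp_add_right]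
  refine (ContinuousMultilinearMap.norm_compContinuousLinearMap_le _ _).trans ?_
  simp only [Finset.prod_const, Finset.card_univ, Fintype.card_fin]
  gcongr
  exact hB _

end

theorem mixedDeriv_eq_iteratedFDeriv {d : ℕ} {E : Type*} [NormedAddCommGroup E] [NormedSpace ℝ E]
    {f : (Fin d → ℝ) → E} (L : List (Fin d)) (hf : ContDiff ℝ L.length f) (x : Fin d → ℝ) :
    mixedDeriv L f x =
      iteratedFDeriv ℝ L.length f x fun i => Pi.single (L.get i) 1 := by
  induction L generalizing x with
  | nil => simp [mixedDeriv]
  | cons i L ih =>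
    have hlt : ((L.length : ℕ) : WithTop ℕ∞) < ((i :: L).length : ℕ) := by
      exact_mod_cast Nat.lt_succ_self L.length
    have hfun : mixedDeriv L f =
        fun y => iteratedFDeriv ℝ L.length f y fun i => Pi.single (L.get i) 1 :=
      funext fun y => ih (hf.of_le hlt.le) y
    change fderiv ℝ (mixedDeriv L f) x (Pi.single i 1) = _
    rw [hfun, fderiv_continuousMultilinear_apply_const_apply
      (hf.differentiable_iteratedFDeriv hlt x)]
    rfl

theorem norm_mixedDeriv_le {d : ℕ} {E : Type*} [NormedAddCommGroup E] [NormedSpace ℝ E]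
    {f : (Fin d → ℝ) → E} (L : List (Fin d)) (hf : ContDiff ℝ L.length f) (x : Fin d → ℝ) :
    ‖mixedDeriv L f x‖ ≤ ‖iteratedFDeriv ℝ L.length f x‖ := by
  rw [mixedDeriv_eq_iteratedFDeriv L hf]
  refine (ContinuousMultilinearMap.le_opNorm _ _).trans ?_
  simp [Pi.norm_single]

/-- The linear functional `x ↦ ∑ l, w l * x l` on `ℝ^d`. -/
noncomputable def weightedSum {d : ℕ} (w : Fin d → ℝ) : (Fin d → ℝ) →L[ℝ] ℝ :=
  ∑ l, w l • ContinuousLinearMap.proj l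

theorem weightedSum_apply {d : ℕ} (w x : Fin d → ℝ) : weightedSum w x = ∑ l, w l * x l := by
  simp [weightedSum]

theorem norm_weightedSum_le {d : ℕ} {w : Fin d → ℝ} {M : ℝ} (hM : 0 ≤ M) (hw : ∀ l, |w l| ≤ M) :
    ‖weightedSum w‖ ≤ d * M := by
  refine ContinuousLinearMap.opNorm_le_bound _ (by positivity) fun x => ?_
  rw [weightedSum_apply]
  refine (norm_sum_le_of_le _ (n := fun _ => M * ‖x‖) fun l _ => ?_).trans (by simp [mul_assoc])
  rw [norm_mul]
  exact mul_le_mul (hw l) (norm_le_pi_norm x l) (norm_nonneg _) hM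

namespace TanhNet

variable {d W₁ W₂ : ℕ} (net : TanhNet d W₁ W₂)

/-- The input of the `i`-th neuron of the second hidden layer. -/
noncomputable def preactivation (i : Fin W₂) (x : Fin d → ℝ) : ℝ :=
  (∑ j, net.Whid i j * Real.tanh (weightedSum (net.Win j) x + net.bin j)) + net.bhid i

theorem eval_eq : net.eval =
    fun x => (∑ i, net.Wout i * (Real.tanh ∘ net.preactivation i) x) + net.bout := by
  funext x
  simp [eval, preactivation, weightedSum_apply]

theorem contDiff_firstLayer {n : WithTop ℕ∞} (j : Fin W₁) :
    ContDiff ℝ n fun x => Real.tanh (weightedSum (net.Win j) x + net.bin j) :=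
  Real.contDiff_tanh.comp ((weightedSum (net.Win j)).contDiff.add contDiff_const)

theorem contDiff_preactivation {n : WithTop ℕ∞} (i : Fin W₂) :
    ContDiff ℝ n (net.preactivation i) :=
  (ContDiff.sum fun j _ => contDiff_const.mul (net.contDiff_firstLayer j)).add contDiff_const

theorem contDiff_eval {n : WithTop ℕ∞} : ContDiff ℝ n net.eval := by
  rw [eval_eq]
  exact (ContDiff.sum fun i _ => contDiff_const.mul
    (Real.contDiff_tanh.comp (net.contDiff_preactivation i))).add contDiff_const

variable {net} {M : ℝ}

theorem WeightsLe.norm_iteratedFDeriv_preactivation_le (hw : net.WeightsLe M) (hM : 1 ≤ M)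
    (hd : 1 ≤ d) (hW : 1 ≤ W₁) {k n : ℕ} (hk : 1 ≤ k) (hn : 1 ≤ n) (hnk : n ≤ k) (i : Fin W₂)
    (x : Fin d → ℝ) :
    ‖iteratedFDeriv ℝ n (net.preactivation i) x‖ ≤
      (2 * (W₁ : ℝ) * M ^ 2 * d * (2 * (k : ℝ)) ^ (2 * k)) ^ n := by
  obtain ⟨hin, -, hhid, hbhid, -, -⟩ := hw
  have hd' : (1 : ℝ) ≤ d := by exact_mod_cast hd
  have hW' : (1 : ℝ) ≤ W₁ := by exact_mod_cast hW
  have hk' : (1 : ℝ) ≤ k := by exact_mod_cast hk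
  set B : ℝ := (2 * (k : ℝ)) ^ (2 * k) with hBdef
  have hB : 1 ≤ B := one_le_pow₀ (by linarith)
  have hlayer (j : Fin W₁) : ‖iteratedFDeriv ℝ n
      (fun x => Real.tanh (weightedSum (net.Win j) x + net.bin j)) x‖ ≤ B * (d * M) ^ n := by
    refine (norm_iteratedFDeriv_comp_clm_add_const_le Real.contDiff_tanh
      (Real.norm_iteratedFDeriv_tanh_le hk hnk) _ _ x).trans ?_
    gcongr
    exact norm_weightedSum_le (by linarith) (hin j)
  have hsum := norm_iteratedFDeriv_sum_const_mul_add_const_le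
    (fun j => net.contDiff_firstLayer j) (hhid i) (hbhid i) hlayer
  rw [Fintype.card_fin] at hsum
  have hdM : 1 ≤ (d : ℝ) * M := one_le_mul_of_one_le_of_one_le hd' hM
  have hP : 1 ≤ (W₁ : ℝ) * (B * (d * M) ^ n) := one_le_mul_of_one_le_of_one_le hW'
    (one_le_mul_of_one_le_of_one_le hB (one_le_pow₀ hdM))
  have hQ : 1 ≤ 2 * (W₁ : ℝ) * M * B := by
    have := one_le_mul_of_one_le_of_one_le (one_le_mul_of_one_le_of_one_le hW' hM) hB
    linarith
  calc _ ≤ (W₁ : ℝ) * (M * (B * (d * M) ^ n)) + M := hsum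
    _ ≤ (2 * (W₁ : ℝ) * M * B) * (d * M) ^ n := by nlinarith
    _ ≤ (2 * (W₁ : ℝ) * M * B) ^ n * (d * M) ^ n := by
      gcongr
      exact le_self_pow₀ hQ (by omega)
    _ = _ := by rw [← mul_pow]; ring

theorem WeightsLe.norm_iteratedFDeriv_eval_le (hw : net.WeightsLe M) (hM : 1 ≤ M)
    (hd : 1 ≤ d) (hW : 1 ≤ W₁) {k n : ℕ} (hk : 1 ≤ k) (hnk : n ≤ k) (x : Fin d → ℝ) :
    ‖iteratedFDeriv ℝ n net.eval x‖ ≤ W₂ * (M * (n.factorial * (2 * (k : ℝ)) ^ (2 * k) *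
      (2 * (W₁ : ℝ) * M ^ 2 * d * (2 * (k : ℝ)) ^ (2 * k)) ^ n)) + M := by
  have h (i : Fin W₂) := norm_iteratedFDeriv_comp_le (N := n) Real.contDiff_tanh
    (net.contDiff_preactivation i) le_rfl x
    (fun m hm => Real.norm_iteratedFDeriv_tanh_le hk (hm.trans hnk) _)
    (fun m h1 hm => hw.norm_iteratedFDeriv_preactivation_le hM hd hW hk h1 (hm.trans hnk) i x)
  have hsum := norm_iteratedFDeriv_sum_const_mul_add_const_le
    (fun i => Real.contDiff_tanh.comp (net.contDiff_preactivation i)) hw.2.2.2.2.1 hw.2.2.2.2.2 h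
  rw [Fintype.card_fin] at hsum
  rwa [eval_eq]

end TanhNet

/-- **Bound on the mixed derivatives of a tanh neural network.**
If `f : ℝ^d → ℝ` is a two-hidden-layer tanh neural network with hidden widths `W ≥ d` and
maximal weight at most `W_max ≥ 1`, then every mixed partial derivative of `f` of order at
most `k` is bounded on `[−1,1]^d` by
`16² (e² k⁴ d²)^{2k} (2k)^{2k(k+1)} W_max^{2k+1} W^{3k+1} d^k`. -/
theorem tanhNet_sobolev_bound (k d W : ℕ) (hk : 1 ≤ k) (hd : 1 ≤ d) (hWd : d ≤ W)
    (Wmax : ℝ) (hWmax : 1 ≤ Wmax)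
    (net : TanhNet d W W) (hw : net.WeightsLe Wmax)
    (L : List (Fin d)) (hL : L.length ≤ k)
    (x : Fin d → ℝ) (hx : ∀ i, x i ∈ Set.Icc (-1 : ℝ) 1) :
    |mixedDeriv L net.eval x| ≤
      16 ^ 2 * (Real.exp 1 ^ 2 * (k : ℝ) ^ 4 * (d : ℝ) ^ 2) ^ (2 * k) *
        (2 * (k : ℝ)) ^ (2 * k * (k + 1)) * Wmax ^ (2 * k + 1) * (W : ℝ) ^ (3 * k + 1) *
        (d : ℝ) ^ k := by
  have hk' : (1 : ℝ) ≤ k := by exact_mod_cast hk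
  have hd' : (1 : ℝ) ≤ d := by exact_mod_cast hd
  have hW : 1 ≤ W := hd.trans hWd
  have hW' : (1 : ℝ) ≤ W := by exact_mod_cast hW
  have hbound := (norm_mixedDeriv_le L net.contDiff_eval x).trans
    (hw.norm_iteratedFDeriv_eval_le hWmax hd hW hk hL x)
  rw [Real.norm_eq_abs] at hbound
  have hfact : (L.length.factorial : ℝ) ≤ (k : ℝ) ^ k := by
    exact_mod_cast (Nat.factorial_le hL).trans (Nat.factorial_le_pow k)
  have hK : 1 ≤ (k : ℝ) ^ k := one_le_pow₀ hk'
  set B : ℝ := (2 * (k : ℝ)) ^ (2 * k) with hBdef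
  have hB : 1 ≤ B := one_le_pow₀ (by linarith)
  set D : ℝ := 2 * (W : ℝ) * Wmax ^ 2 * d * B with hDdef
  have hD : 1 ≤ D := by
    have := one_le_mul_of_one_le_of_one_le (one_le_mul_of_one_le_of_one_le
      (one_le_mul_of_one_le_of_one_le hW' (one_le_pow₀ hWmax (n := 2))) hd') hB
    linarith
  have hP : 1 ≤ (W : ℝ) * ((k : ℝ) ^ k * B * D ^ k) := one_le_mul_of_one_le_of_one_le hW'
    (one_le_mul_of_one_le_of_one_le (one_le_mul_of_one_le_of_one_le hK hB) (one_le_pow₀ hD))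
  have hbase : 2 * (k : ℝ) ≤ Real.exp 1 ^ 2 * (k : ℝ) ^ 4 * (d : ℝ) ^ 2 := by
    have he : 2 ≤ Real.exp 1 := by linarith [Real.add_one_le_exp (1 : ℝ)]
    calc 2 * (k : ℝ) = 2 * k * 1 := by ring
      _ ≤ Real.exp 1 ^ 2 * (k : ℝ) ^ 4 * (d : ℝ) ^ 2 := by
        gcongr
        · nlinarith
        · exact le_self_pow₀ hk' (by norm_num)
        · exact one_le_pow₀ hd'
  have hpow : (2 * (k : ℝ)) ^ k ≤
      (Real.exp 1 ^ 2 * (k : ℝ) ^ 4 * (d : ℝ) ^ 2) ^ (2 * k) :=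
    (pow_le_pow_left₀ (by positivity) hbase k).trans
      (pow_le_pow_right₀ (by linarith) (by omega))
  calc |mixedDeriv L net.eval x|
      ≤ W * (Wmax * (L.length.factorial * B * D ^ L.length)) + Wmax := hbound
    _ ≤ W * (Wmax * ((k : ℝ) ^ k * B * D ^ k)) + Wmax := by
      gcongr
    _ ≤ 2 * (W * (Wmax * ((k : ℝ) ^ k * B * D ^ k))) := by nlinarith
    _ = 2 * (2 * (k : ℝ)) ^ k * (2 * (k : ℝ)) ^ (2 * k * (k + 1)) * Wmax ^ (2 * k + 1) *
        (W : ℝ) ^ (k + 1) * (d : ℝ) ^ k := by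
      rw [pow_mul (2 * (k : ℝ)) (2 * k) (k + 1), ← hBdef, hDdef]
      simp only [mul_pow, pow_succ, pow_mul]
      ring
    _ ≤ _ := by
      gcongr
      · norm_num
      · omega
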